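/- For a λ-quasi-convex function u on an open set U ⊆ ℝⁿ and a closed positivity-satisfying set F ⊆ U × ℝ × ℝⁿ × Sym²(ℝⁿ), the following are equivalent: (i) u is F-subharmonic on U (every upper contact jet (p,A) at every x satisfies (x,u(x),p,A) ∈ F); (ii) for almost every x ∈ U, u is twice differentiable at x and (x, u(x), Du(x), D²u(x)) ∈ F. -/

import Mathlib

open scoped RealInnerProductSpace Topology
open Filter MeasureTheory

/-- The quadratic form `⟨A v, v⟩` associated to a matrix `A`. -/
noncomputable def quad {n : ℕ} (A : Matrix (Fin n) (Fin n) ℝ)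
    (v : EuclideanSpace ℝ (Fin n)) : ℝ :=
  ∑ i, ∑ j, A i j * v i * v j

/-- `(p, A)` is an upper contact jet for `w` at `x₀`. -/
def UpperContactJet {n : ℕ} (w : EuclideanSpace ℝ (Fin n) → ℝ)
    (x₀ p : EuclideanSpace ℝ (Fin n)) (A : Matrix (Fin n) (Fin n) ℝ) : Prop :=
  ∀ᶠ y in 𝓝 x₀, w y ≤ w x₀ + ⟪p, y - x₀⟫ + (1 / 2) * quad A (y - x₀)

/-- `w` is twice differentiable at `x` with gradient `g` and Hessian `H`, in the sense of
a second-order Taylor expansion. -/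
def TwiceDiffAt {n : ℕ} (w : EuclideanSpace ℝ (Fin n) → ℝ)
    (x g : EuclideanSpace ℝ (Fin n)) (H : Matrix (Fin n) (Fin n) ℝ) : Prop :=
  HasGradientAt w g x ∧
    (fun y => w y - w x - ⟪g, y - x⟫ - (1 / 2) * quad H (y - x)) =o[𝓝 x]
      fun y => ‖y - x‖ ^ 2

/-- `w` is `lam`-quasi-convex on `U`: `w + (lam/2)|·|²` is convex on `U`. -/
def QCOn {n : ℕ} (lam : ℝ) (U : Set (EuclideanSpace ℝ (Fin n)))
    (w : EuclideanSpace ℝ (Fin n) → ℝ) : Prop :=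
  ConvexOn ℝ U (fun x => w x + (lam / 2) * ‖x‖ ^ 2)

/-- The 2-jet space `ℝⁿ × ℝ × ℝⁿ × Sym²(ℝⁿ)` (symmetry imposed separately). -/
abbrev Jet (n : ℕ) :=
  EuclideanSpace ℝ (Fin n) × ℝ × EuclideanSpace ℝ (Fin n) × Matrix (Fin n) (Fin n) ℝ

/-- Positivity condition (P) for a set of 2-jets. -/
def Positivity {n : ℕ} (F : Set (Jet n)) : Prop :=
  ∀ x : EuclideanSpace ℝ (Fin n), ∀ r : ℝ, ∀ p : EuclideanSpace ℝ (Fin n),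
    ∀ A P : Matrix (Fin n) (Fin n) ℝ,
      (x, r, p, A) ∈ F → P.PosSemidef → (x, r, p, A + P) ∈ F

/-- `u` is `F`-subharmonic on `U`: every upper contact jet of `u` at a point of `U`
belongs to `F`. -/
def Subharm {n : ℕ} (F : Set (Jet n)) (U : Set (EuclideanSpace ℝ (Fin n)))
    (u : EuclideanSpace ℝ (Fin n) → ℝ) : Prop :=
  ∀ x ∈ U, ∀ (p : EuclideanSpace ℝ (Fin n)) (A : Matrix (Fin n) (Fin n) ℝ),
    A.IsSymm → UpperContactJet u x p A → (x, u x, p, A) ∈ F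

section Convex

variable {E : Type*} [NormedAddCommGroup E] [InnerProductSpace ℝ E]

/-- `q` is a subgradient at `x` of the restriction of `f` to `U`. -/
def IsSubgradientOn (f : E → ℝ) (U : Set E) (x q : E) : Prop :=
  ∀ z ∈ U, f x + ⟪q, z - x⟫ ≤ f z

theorem ConvexOn.exists_isSubgradientOn [CompleteSpace E] {f : E → ℝ} {U : Set E}
    (hf : ConvexOn ℝ U f) (hU : IsOpen U) (hc : ContinuousOn f U) {x : E} (hx : x ∈ U) :
    ∃ q, IsSubgradientOn f U x q := by
  have hopen : IsOpen {p : E × ℝ | p.1 ∈ U ∧ f p.1 < p.2} := by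
    have h1 : ContinuousOn (fun p : E × ℝ => p.2 - f p.1) (U ×ˢ Set.univ) :=
      continuousOn_snd.sub (hc.comp continuousOn_fst fun p hp => hp.1)
    convert h1.isOpen_inter_preimage (hU.prod isOpen_univ) (isOpen_Ioi (a := (0 : ℝ))) using 1
    ext p
    simp
  obtain ⟨φ, hφ⟩ := geometric_hahn_banach_open_point hf.convex_strict_epigraph hopen
    (x := (x, f x)) (by simp)
  have hsplit : ∀ z t, φ (z, t) = φ (z, 0) + t * φ (0, 1) := fun z t => by
    rw [← smul_eq_mul, ← map_smul, ← map_add]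
    simp
  have hneg : φ (0, 1) < 0 := by
    have := hφ (x, f x + 1) ⟨hx, by simp⟩
    rw [hsplit x (f x + 1), hsplit x (f x)] at this
    linarith
  set ψ : E →L[ℝ] ℝ := φ.comp (ContinuousLinearMap.inl ℝ E ℝ) with hψ
  refine ⟨(-φ (0, 1))⁻¹ • (InnerProductSpace.toDual ℝ E).symm ψ, fun z hz => ?_⟩
  have hle : φ (z, f z) ≤ φ (x, f x) := by
    have ht : Tendsto (fun t : ℝ => φ (z, t)) (𝓝[>] (f z)) (𝓝 (φ (z, f z))) :=
      ((φ.continuous.comp (Continuous.prodMk_right z)).tendsto _).mono_left nhdsWithin_le_nhds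
    exact le_of_tendsto ht (eventually_nhdsWithin_of_forall fun t ht => (hφ (z, t) ⟨hz, ht⟩).le)
  rw [hsplit z, hsplit x] at hle
  rw [inner_smul_left, InnerProductSpace.toDual_symm_apply]
  have h2 : ψ (z - x) = φ (z, 0) - φ (x, 0) := by
    rw [map_sub]; simp [hψ]
  rw [h2]
  simp only [conj_trivial]
  have h3 : (-φ (0, 1))⁻¹ * (φ (z, 0) - φ (x, 0)) ≤ f z - f x := by
    rw [inv_mul_le_iff₀ (by linarith)]
    nlinarith
  linarith

theorem IsSubgradientOn.eventually_norm_sub_le {f : E → ℝ} {U : Set E} [CompleteSpace E]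
    {x p : E} (hU : U ∈ 𝓝 x) (hp : HasGradientAt f p x) {ε : ℝ} (hε : 0 < ε) :
    ∀ᶠ z in 𝓝 x, ∀ q, IsSubgradientOn f U z q → ‖q - p‖ ≤ ε := by
  have h1 := (hasGradientAt_iff_isLittleO.1 hp).def (c := ε / 3) (by positivity)
  obtain ⟨δ, hδ, hb⟩ := Metric.eventually_nhds_iff.1 (h1.and hU)
  refine Metric.eventually_nhds_iff.2 ⟨δ / 4, by positivity, fun z hz q hq => ?_⟩
  rcases eq_or_ne q p with rfl | hne
  · simpa using hε.le
  have hn : 0 < ‖q - p‖ := norm_pos_iff.2 (sub_ne_zero.2 hne)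
  set e : E := (δ / 4 / ‖q - p‖) • (q - p) with he
  have hen : ‖e‖ = δ / 4 := by
    rw [he, norm_smul, Real.norm_of_nonneg (by positivity)]
    field_simp
  have hin : ⟪q - p, e⟫ = δ / 4 * ‖q - p‖ := by
    rw [he, inner_smul_right, real_inner_self_eq_norm_sq]
    field_simp
  rw [dist_eq_norm] at hz
  have hw : ‖z + e - x‖ ≤ δ / 2 := by
    calc ‖z + e - x‖ = ‖(z - x) + e‖ := by congr 1; abel
      _ ≤ ‖z - x‖ + ‖e‖ := norm_add_le _ _
      _ ≤ δ / 2 := by linarith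
  have hA := hb (y := z + e) (by rw [dist_eq_norm]; linarith)
  have hB := (hb (y := z) (by rw [dist_eq_norm]; linarith)).1
  have hC := hq _ hA.2
  have hA1 := hA.1
  simp only [Real.norm_eq_abs] at hA1 hB
  have e1 : ⟪p, z + e - x⟫ = ⟪p, z - x⟫ + ⟪p, e⟫ := by rw [← inner_add_right]; congr 1; abel
  rw [add_sub_cancel_left] at hC
  rw [inner_sub_left] at hin
  rw [e1] at hA1
  have := (abs_le.1 hA1).2
  have := (abs_le.1 hB).1
  have h5 : δ / 4 * ‖q - p‖ ≤ δ / 4 * ε := by nlinarith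
  exact le_of_mul_le_mul_left h5 (by positivity)

end Convex

theorem le_of_sub_le_mul_sq {χ : ℝ → ℝ} {C : ℝ}
    (h : ∀ s t, 0 ≤ s → s ≤ t → t ≤ 1 → χ t - χ s ≤ C * (t - s) ^ 2) : χ 1 ≤ χ 0 := by
  have key : ∀ N : ℕ, χ 1 - χ 0 ≤ C * (1 / ((N : ℝ) + 1)) := by
    intro N
    have hN : (0 : ℝ) < (N : ℝ) + 1 := by positivity
    have hk : ∀ k : ℕ, k ≤ N + 1 →
        χ (k / ((N : ℝ) + 1)) - χ 0 ≤ k * (C / ((N : ℝ) + 1) ^ 2) := by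
      intro k
      induction k with
      | zero => simp
      | succ k ih =>
        intro hk
        have h1 := ih (by omega)
        have h2 := h (k / ((N : ℝ) + 1)) ((k + 1 : ℕ) / ((N : ℝ) + 1)) (by positivity)
          (by gcongr; simp) (by rw [div_le_one hN]; exact_mod_cast hk)
        have h3 : C * (((k + 1 : ℕ) : ℝ) / ((N : ℝ) + 1) - k / ((N : ℝ) + 1)) ^ 2
            = C / ((N : ℝ) + 1) ^ 2 := by
          push_cast; field_simp; ring
        rw [h3] at h2
        push_cast at h2 ⊢
        linarith
    have h4 := hk (N + 1) le_rfl
    push_cast at h4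
    rw [div_self hN.ne'] at h4
    calc _ ≤ _ := h4
      _ = _ := by field_simp
  have ht : Tendsto (fun N : ℕ => C * (1 / ((N : ℝ) + 1))) atTop (𝓝 (C * 0)) :=
    tendsto_one_div_add_atTop_nhds_zero_nat.const_mul C
  rw [mul_zero] at ht
  linarith [ge_of_tendsto' ht key]

theorem sub_le_of_subgradient_le {φ d : ℝ → ℝ} {a b : ℝ}
    (hd : ∀ s ∈ Set.Icc (0 : ℝ) 1, ∀ t ∈ Set.Icc (0 : ℝ) 1, φ t + d t * (s - t) ≤ φ s)
    (hab : ∀ t ∈ Set.Icc (0 : ℝ) 1, d t ≤ a + b * t) : φ 1 - φ 0 ≤ a + b / 2 := by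
  have := le_of_sub_le_mul_sq (χ := fun t => φ t - a * t - b / 2 * t ^ 2) (C := b / 2)
    fun s t hs hst ht => by
      have h1 := hd s ⟨hs, by linarith⟩ t ⟨by linarith, ht⟩
      have h2 := mul_le_mul_of_nonneg_right (hab t ⟨by linarith, ht⟩) (sub_nonneg.2 hst)
      linear_combination h1 + h2
  linarith

theorem le_sub_of_le_subgradient {φ d : ℝ → ℝ} {a b : ℝ}
    (hd : ∀ s ∈ Set.Icc (0 : ℝ) 1, ∀ t ∈ Set.Icc (0 : ℝ) 1, φ t + d t * (s - t) ≤ φ s)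
    (hab : ∀ t ∈ Set.Icc (0 : ℝ) 1, a + b * t ≤ d t) : a + b / 2 ≤ φ 1 - φ 0 := by
  have := le_of_sub_le_mul_sq (χ := fun t => a * t + b / 2 * t ^ 2 - φ t) (C := b / 2)
    fun s t hs hst ht => by
      have h1 := hd t ⟨by linarith, ht⟩ s ⟨hs, by linarith⟩
      have h2 := mul_le_mul_of_nonneg_right (hab s ⟨hs, by linarith⟩) (sub_nonneg.2 hst)
      linear_combination h1 + h2
  linarith

section Lipschitz

variable {E : Type*} [NormedAddCommGroup E] [InnerProductSpace ℝ E] [FiniteDimensional ℝ E]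

theorem exists_lipschitzWith_of_rel {R : E → E → Prop} {C : ℝ}
    (h : ∀ a b a' b', R a b → R a' b' → ‖b - b'‖ ≤ C * ‖a - a'‖) :
    ∃ K, ∃ Φ : E → E, LipschitzWith K Φ ∧ ∀ a b, R a b → Φ a = b := by
  classical
  let g : E → E := fun a => if ha : ∃ b, R a b then ha.choose else 0
  have hg : ∀ a b, R a b → R a (g a) := fun a b hab => by
    have ha : ∃ b, R a b := ⟨b, hab⟩
    simp only [g, dif_pos ha]
    exact ha.choose_spec
  have hL : LipschitzOnWith C.toNNReal g {a | ∃ b, R a b} := by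
    refine LipschitzOnWith.of_dist_le_mul fun a ⟨b, hab⟩ a' ⟨b', hab'⟩ => ?_
    rw [dist_eq_norm, dist_eq_norm]
    exact (h _ _ _ _ (hg a b hab) (hg a' b' hab')).trans
      (mul_le_mul_of_nonneg_right (Real.le_coe_toNNReal C) (norm_nonneg _))
  obtain ⟨Φ, hΦ, heq⟩ := hL.extend_finite_dimension
  refine ⟨_, Φ, hΦ, fun a b hab => ?_⟩
  rw [← heq ⟨b, hab⟩]
  have := h _ _ _ _ (hg a b hab) hab
  simpa [sub_eq_zero] using this

theorem LipschitzWith.volume_image_eq_zero [MeasurableSpace E] [BorelSpace E] {K : NNReal}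
    {Φ : E → E} (hΦ : LipschitzWith K Φ) {N : Set E} (hN : volume N = 0) :
    volume (Φ '' N) = 0 := by
  have hH : (Measure.hausdorffMeasure (Module.finrank ℝ E) : Measure E).IsAddHaarMeasure :=
    isAddHaarMeasure_hausdorffMeasure
  have h1 : (Measure.hausdorffMeasure (Module.finrank ℝ E) : Measure E) N = 0 :=
    Measure.absolutelyContinuous_isAddHaarMeasure _ volume hN
  have h2 := hΦ.hausdorffMeasure_image_le (d := Module.finrank ℝ E) (by positivity) N
  rw [h1, mul_zero, nonpos_iff_eq_zero] at h2
  exact Measure.absolutelyContinuous_isAddHaarMeasure volume _ h2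

end Lipschitz

section Alexandrov

variable {E : Type*} [NormedAddCommGroup E] [InnerProductSpace ℝ E]

theorem HasFDerivAt.eventually_subgradient_expansion {f : E → ℝ} {U : Set E} [CompleteSpace E]
    {x p : E} (hU : U ∈ 𝓝 x) (hp : HasGradientAt f p x) {Φ : E → E} {D : E ≃L[ℝ] E}
    (hΦ : HasFDerivAt Φ (D : E →L[ℝ] E) (x + p)) (hx : Φ (x + p) = x)
    (hΦU : ∀ z ∈ U, ∀ q, IsSubgradientOn f U z q → Φ (z + q) = z) {ε : ℝ} (hε : 0 < ε) :
    ∀ᶠ z in 𝓝 x, ∀ q, IsSubgradientOn f U z q →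
      ‖q - p - (D.symm (z - x) - (z - x))‖ ≤ ε * ‖z - x‖ := by
  set M : ℝ := ‖(D.symm : E →L[ℝ] E)‖ + 1 with hM
  have hM0 : 0 < M := by positivity
  have hDM : ∀ v, ‖D.symm v‖ ≤ M * ‖v‖ := fun v =>
    ((D.symm : E →L[ℝ] E).le_opNorm v).trans (by gcongr; linarith)
  set η : ℝ := min (1 / (2 * M)) (ε / (2 * M ^ 2)) with hη
  have hη0 : 0 < η := by positivity
  have hη1 : M * η ≤ 1 / 2 := by
    calc M * η ≤ M * (1 / (2 * M)) := by gcongr; exact min_le_left _ _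
      _ = 1 / 2 := by field_simp
  have hη2 : 2 * M ^ 2 * η ≤ ε := by
    calc 2 * M ^ 2 * η ≤ 2 * M ^ 2 * (ε / (2 * M ^ 2)) := by gcongr; exact min_le_right _ _
      _ = ε := by field_simp
  obtain ⟨δ, hδ, hb⟩ := Metric.eventually_nhds_iff.1 (hΦ.isLittleO.def hη0)
  filter_upwards [IsSubgradientOn.eventually_norm_sub_le hU hp (half_pos hδ), hU,
    Metric.ball_mem_nhds x (half_pos hδ)] with z hz hzU hzx q hq
  have h1 := hz q hq
  rw [mem_ball_iff_norm] at hzx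
  set v : E := z + q - (x + p) with hv
  have hvz : v = (z - x) + (q - p) := by rw [hv]; abel
  have hvδ : ‖v‖ < δ := by
    rw [hvz]; linarith [norm_add_le (z - x) (q - p)]
  have h2 := hb (y := z + q) (by rw [dist_eq_norm]; exact hvδ)
  rw [hΦU z hzU q hq, hx, ← hv] at h2
  have h3 : v - D.symm (z - x) = -D.symm (z - x - D v) := by
    rw [map_sub D.symm (z - x), D.symm_apply_apply, neg_sub]
  have h4 : ‖v - D.symm (z - x)‖ ≤ M * (η * ‖v‖) := by
    rw [h3, norm_neg]
    exact (hDM _).trans (by gcongr; exact h2)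
  have h5 : ‖v‖ ≤ 2 * M * ‖z - x‖ := by
    have := norm_add_le (v - D.symm (z - x)) (D.symm (z - x))
    rw [sub_add_cancel] at this
    have := hDM (z - x)
    nlinarith [norm_nonneg v]
  have h6 : q - p - (D.symm (z - x) - (z - x)) = v - D.symm (z - x) := by
    rw [hvz]; abel
  rw [h6]
  calc _ ≤ M * (η * ‖v‖) := h4
    _ ≤ M * (η * (2 * M * ‖z - x‖)) := by gcongr
    _ = 2 * M ^ 2 * η * ‖z - x‖ := by ring
    _ ≤ ε * ‖z - x‖ := by gcongr

theorem isLittleO_of_subgradient_expansion {f : E → ℝ} {U : Set E} {x p : E} (hU : U ∈ 𝓝 x)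
    (hsub : ∀ z ∈ U, ∃ q, IsSubgradientOn f U z q) (L : E →L[ℝ] E)
    (hL : ∀ ε > 0, ∀ᶠ z in 𝓝 x, ∀ q, IsSubgradientOn f U z q →
      ‖q - p - L (z - x)‖ ≤ ε * ‖z - x‖) :
    (fun z => f z - f x - ⟪p, z - x⟫ - (1 / 2) * ⟪L (z - x), z - x⟫) =o[𝓝 x]
      fun z => ‖z - x‖ ^ 2 := by
  refine Asymptotics.isLittleO_iff.2 fun ε hε => ?_
  obtain ⟨δ, hδ, hb⟩ := Metric.eventually_nhds_iff.1 ((hL ε hε).and hU)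
  refine Metric.eventually_nhds_iff.2 ⟨δ, hδ, fun z hz => ?_⟩
  set h : E := z - x with hh
  rw [dist_eq_norm, ← hh] at hz
  have hseg : ∀ t ∈ Set.Icc (0 : ℝ) 1, dist (x + t • h) x < δ := fun t ht => by
    rw [dist_eq_norm, add_sub_cancel_left, norm_smul, Real.norm_of_nonneg ht.1]
    nlinarith [norm_nonneg h, ht.2]
  have hq : ∀ t : ℝ, ∃ q, t ∈ Set.Icc (0 : ℝ) 1 → IsSubgradientOn f U (x + t • h) q := fun t => by
    by_cases ht : t ∈ Set.Icc (0 : ℝ) 1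
    · obtain ⟨q, hq⟩ := hsub _ (hb (hseg t ht)).2
      exact ⟨q, fun _ => hq⟩
    · exact ⟨0, fun h => absurd h ht⟩
  choose q hq using hq
  have hd : ∀ s ∈ Set.Icc (0 : ℝ) 1, ∀ t ∈ Set.Icc (0 : ℝ) 1,
      f (x + t • h) + ⟪q t, h⟫ * (s - t) ≤ f (x + s • h) := fun s hs t ht => by
    have := hq t ht _ (hb (hseg s hs)).2
    have e : x + s • h - (x + t • h) = (s - t) • h := by rw [sub_smul]; abel
    rw [e, inner_smul_right] at this
    linarith
  have hbd : ∀ t ∈ Set.Icc (0 : ℝ) 1,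
      |⟪q t, h⟫ - ⟪p, h⟫ - t * ⟪L h, h⟫| ≤ ε * ‖h‖ ^ 2 * t := fun t ht => by
    have h1 := (hb (hseg t ht)).1 (q t) (hq t ht)
    rw [add_sub_cancel_left, map_smul, norm_smul, Real.norm_of_nonneg ht.1] at h1
    have h2 := abs_real_inner_le_norm (q t - p - t • L h) h
    rw [inner_sub_left, inner_sub_left, inner_smul_left, conj_trivial] at h2
    calc _ ≤ _ := h2
      _ ≤ ε * (t * ‖h‖) * ‖h‖ := by gcongr
      _ = _ := by ring
  have hup := sub_le_of_subgradient_le (φ := fun t => f (x + t • h)) (a := ⟪p, h⟫)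
    (b := ⟪L h, h⟫ + ε * ‖h‖ ^ 2) hd fun t ht => by linarith [(abs_le.1 (hbd t ht)).2]
  have hlow := le_sub_of_le_subgradient (φ := fun t => f (x + t • h)) (a := ⟪p, h⟫)
    (b := ⟪L h, h⟫ - ε * ‖h‖ ^ 2) hd fun t ht => by linarith [(abs_le.1 (hbd t ht)).1]
  have e1 : x + (1 : ℝ) • h = z := by rw [one_smul, hh]; abel
  simp only [e1, zero_smul, add_zero] at hup hlow
  rw [Real.norm_eq_abs, Real.norm_of_nonneg (by positivity), abs_le]
  have : 0 ≤ ε * ‖h‖ ^ 2 := by positivity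
  constructor <;> linarith

variable [FiniteDimensional ℝ E] [MeasurableSpace E] [BorelSpace E]

theorem ConvexOn.ae_differentiableAt {f : E → ℝ} {U : Set E} (hf : ConvexOn ℝ U f)
    (hU : IsOpen U) : ∀ᵐ x : E, x ∈ U → DifferentiableAt ℝ f x := by
  rw [ae_iff]
  refine measure_null_of_locally_null _ fun x hx => ?_
  simp only [Classical.not_imp, Set.mem_ofPred_eq] at hx
  obtain ⟨K, t, ht, hK⟩ := hf.locallyLipschitzOn hU hx.1
  rw [hU.nhdsWithin_eq hx.1] at ht
  obtain ⟨s, hst, hs, hxs⟩ := mem_nhds_iff.1 ht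
  refine ⟨s ∩ {x | ¬(x ∈ U → DifferentiableAt ℝ f x)},
    inter_mem (mem_nhdsWithin_of_mem_nhds (hs.mem_nhds hxs)) self_mem_nhdsWithin, ?_⟩
  have := (hK.mono hst).ae_differentiableWithinAt_of_mem (μ := volume)
  rw [ae_iff] at this
  refine measure_mono_null (fun y hy => ?_) this
  simp only [Set.mem_inter_iff, Classical.not_imp, Set.mem_ofPred_eq] at hy ⊢
  exact ⟨hy.1, fun h => hy.2.2 (h.differentiableAt (hs.mem_nhds hy.1))⟩

/-- **Alexandrov's theorem**: a convex function on an open subset of a finite-dimensional space has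
a second-order Taylor expansion at almost every point. -/
theorem ConvexOn.ae_exists_taylor_two {f : E → ℝ} {U : Set E} (hf : ConvexOn ℝ U f)
    (hU : IsOpen U) : ∀ᵐ x : E, x ∈ U → ∃ (p : E) (L : E →L[ℝ] E), HasGradientAt f p x ∧
      (fun z => f z - f x - ⟪p, z - x⟫ - (1 / 2) * ⟪L (z - x), z - x⟫) =o[𝓝 x]
        fun z => ‖z - x‖ ^ 2 := by
  have hsub : ∀ z ∈ U, ∃ q, IsSubgradientOn f U z q := fun z hz =>
    hf.exists_isSubgradientOn hU (hf.continuousOn hU) hz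
  obtain ⟨K, Φ, hΦ, hΦR⟩ := exists_lipschitzWith_of_rel (C := 1)
    (R := fun y x => x ∈ U ∧ IsSubgradientOn f U x (y - x)) fun y x y' x' hx hx' => by
      have h1 := hx.2 x' hx'.1
      have h2 := hx'.2 x hx.1
      have e : ⟪y - y', x - x'⟫ = ‖x - x'‖ ^ 2 - ⟪y - x, x' - x⟫ - ⟪y' - x', x - x'⟫ := by
        rw [← neg_sub x x', inner_neg_right, ← real_inner_self_eq_norm_sq]
        simp only [inner_sub_left, inner_sub_right]; ring
      have h3 := real_inner_le_norm (y - y') (x - x')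
      rcases (norm_nonneg (x - x')).eq_or_lt with h0 | h0
      · rw [← h0]; positivity
      · refine le_of_mul_le_mul_right ?_ h0
        nlinarith
  have hΦU : ∀ z ∈ U, ∀ q, IsSubgradientOn f U z q → Φ (z + q) = z := fun z hz q hq =>
    hΦR _ _ ⟨hz, by rwa [add_sub_cancel_left]⟩
  have hN1 : volume (Φ '' {y | ¬DifferentiableAt ℝ Φ y}) = 0 :=
    hΦ.volume_image_eq_zero (ae_iff.1 hΦ.ae_differentiableAt)
  have hN2 : volume (Φ '' {y | DifferentiableAt ℝ Φ y ∧ (fderiv ℝ Φ y).det = 0}) = 0 :=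
    addHaar_image_eq_zero_of_det_fderivWithin_eq_zero volume
      (fun y hy => hy.1.hasFDerivAt.hasFDerivWithinAt) fun y hy => hy.2
  filter_upwards [hf.ae_differentiableAt hU, measure_eq_zero_iff_ae_notMem.1 hN1,
    measure_eq_zero_iff_ae_notMem.1 hN2] with x hd hx1 hx2 hxU
  have hp := (hd hxU).hasGradientAt
  set p := gradient f x
  have hUx := hU.mem_nhds hxU
  obtain ⟨q, hq⟩ := hsub x hxU
  have hqp : q = p := by
    rw [← sub_eq_zero, ← norm_le_zero_iff]
    refine le_of_forall_pos_le_add fun ε hε => ?_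
    rw [zero_add]
    exact (IsSubgradientOn.eventually_norm_sub_le hUx hp hε).self_of_nhds q hq
  rw [hqp] at hq
  have hΦx := hΦU x hxU _ hq
  have hdiff : DifferentiableAt ℝ Φ (x + p) := by
    by_contra h
    exact hx1 ⟨_, h, hΦx⟩
  have hdet : (fderiv ℝ Φ (x + p)).det ≠ 0 := fun h => hx2 ⟨_, ⟨hdiff, h⟩, hΦx⟩
  set D := (fderiv ℝ Φ (x + p)).toContinuousLinearEquivOfDetNeZero hdet with hD
  refine ⟨p, (D.symm : E →L[ℝ] E) - ContinuousLinearMap.id ℝ E, hp,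
    isLittleO_of_subgradient_expansion hUx hsub _ fun ε hε => ?_⟩
  exact HasFDerivAt.eventually_subgradient_expansion hUx hp (D := D) (by
    rw [hD, ContinuousLinearMap.coe_toContinuousLinearEquivOfDetNeZero]
    exact hdiff.hasFDerivAt) hΦx hΦU hε

end Alexandrov

section Contact

variable {E : Type*} [NormedAddCommGroup E] [InnerProductSpace ℝ E]

theorem eq_zero_of_inner_le_mul_norm_sq {v : E} {C r : ℝ} (hr : 0 < r)
    (h : ∀ z, ‖z‖ < r → ⟪v, z⟫ ≤ C * ‖z‖ ^ 2) : v = 0 := by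
  by_contra hv
  have hn : 0 < ‖v‖ := norm_pos_iff.2 hv
  set t : ℝ := min (r / (2 * ‖v‖)) (1 / (2 * (|C| + 1))) with ht
  have ht0 : 0 < t := by positivity
  have ht1 : t * ‖v‖ < r := by
    calc t * ‖v‖ ≤ r / (2 * ‖v‖) * ‖v‖ := by gcongr; exact min_le_left _ _
      _ = r / 2 := by field_simp
      _ < r := half_lt_self hr
  have ht2 : t * (|C| + 1) ≤ 1 / 2 := by
    calc t * (|C| + 1) ≤ 1 / (2 * (|C| + 1)) * (|C| + 1) := by gcongr; exact min_le_right _ _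
      _ = 1 / 2 := by field_simp
  have h1 := h (t • v) (by rwa [norm_smul, Real.norm_of_nonneg ht0.le])
  rw [inner_smul_right, real_inner_self_eq_norm_sq, norm_smul, Real.norm_of_nonneg ht0.le] at h1
  have h2 : t * ‖v‖ ^ 2 * 1 ≤ t * ‖v‖ ^ 2 * (C * t) := by linear_combination h1
  have h3 := le_of_mul_le_mul_left h2 (by positivity)
  nlinarith [le_abs_self C]

/-- If `w` is touched from above by affine functions with slopes `q₁`, `q₂` at `y₁`, `y₂`, and from
below by a paraboloid with slope `q₁` at `y₁`, then the slopes are controlled by the points. -/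
theorem norm_sub_le_of_contact {w : E → ℝ} {B : Set E} {Λ : ℝ} {y₁ y₂ q₁ q₂ : E}
    (hΛ : 0 ≤ Λ) (hB : Metric.closedBall y₂ ‖y₂ - y₁‖ ⊆ B) (hB' : B ∈ 𝓝 y₁)
    (hlow : ∀ z ∈ B, w y₁ + ⟪q₁, z - y₁⟫ - Λ * ‖z - y₁‖ ^ 2 ≤ w z)
    (hup₁ : ∀ z ∈ B, w z ≤ w y₁ + ⟪q₁, z - y₁⟫)
    (hup₂ : ∀ z ∈ B, w z ≤ w y₂ + ⟪q₂, z - y₂⟫) :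
    ‖q₂ - q₁‖ ≤ 4 * Λ * ‖y₂ - y₁‖ := by
  have hy₂ : y₂ ∈ B := hB (Metric.mem_closedBall_self (norm_nonneg _))
  have key : ∀ z ∈ B, ⟪q₁ - q₂, z - y₂⟫ ≤ Λ * ‖z - y₁‖ ^ 2 := fun z hz => by
    have h1 := hlow z hz
    have h2 := hup₁ y₂ hy₂
    have h3 := hup₂ z hz
    have e : ⟪q₁ - q₂, z - y₂⟫ = ⟪q₁, z - y₁⟫ - ⟪q₁, y₂ - y₁⟫ - ⟪q₂, z - y₂⟫ := by
      simp only [inner_sub_left, inner_sub_right]; ring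
    linarith
  rcases eq_or_ne y₁ y₂ with rfl | hne
  · obtain ⟨r, hr, hrB⟩ := Metric.mem_nhds_iff.1 hB'
    have h0 : q₁ - q₂ = 0 := eq_zero_of_inner_le_mul_norm_sq (C := Λ) hr fun z hz => by
      simpa using key (y₁ + z) (hrB (by simpa using hz))
    rw [← norm_sub_rev, h0]
    simp
  rcases eq_or_ne q₁ q₂ with rfl | hqne
  · rw [sub_self, norm_zero]; positivity
  have hb : 0 < ‖y₂ - y₁‖ := norm_pos_iff.2 (sub_ne_zero.2 hne.symm)
  have ha : 0 < ‖q₁ - q₂‖ := norm_pos_iff.2 (sub_ne_zero.2 hqne)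
  set e : E := (‖y₂ - y₁‖ / ‖q₁ - q₂‖) • (q₁ - q₂) with he
  have hen : ‖e‖ = ‖y₂ - y₁‖ := by
    rw [he, norm_smul, Real.norm_of_nonneg (by positivity)]; field_simp
  have h1 := key (y₂ + e) (hB (by simp [hen]))
  rw [add_sub_cancel_left, he, inner_smul_right, real_inner_self_eq_norm_sq, ← he] at h1
  have h2 : ‖y₂ + e - y₁‖ ≤ 2 * ‖y₂ - y₁‖ := by
    calc ‖y₂ + e - y₁‖ = ‖(y₂ - y₁) + e‖ := by congr 1; abel
      _ ≤ ‖y₂ - y₁‖ + ‖e‖ := norm_add_le _ _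
      _ = _ := by rw [hen]; ring
  rw [norm_sub_rev q₂]
  refine le_of_mul_le_mul_left ?_ hb
  calc ‖y₂ - y₁‖ * ‖q₁ - q₂‖ = ‖y₂ - y₁‖ / ‖q₁ - q₂‖ * ‖q₁ - q₂‖ ^ 2 := by field_simp
    _ ≤ Λ * ‖y₂ + e - y₁‖ ^ 2 := h1
    _ ≤ Λ * (2 * ‖y₂ - y₁‖) ^ 2 := by gcongr
    _ = _ := by ring

theorem exists_affine_contact [FiniteDimensional ℝ E] {w : E → ℝ} {x q : E} {r ε : ℝ} (hr : 0 < r)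
    (hε : 0 < ε) (hc : ContinuousOn w (Metric.ball x r))
    (hmax : ∀ y ∈ Metric.ball x r, w y ≤ w x - ε * ‖y - x‖ ^ 2) (hq : ‖q‖ ≤ ε * (r / 2)) :
    ∃ y, ‖y - x‖ ≤ r / 2 ∧ ε * ‖y - x‖ ≤ ‖q‖ ∧
      ∀ z ∈ Metric.ball x r, w z ≤ w y + ⟪q, z - y⟫ := by
  have hsub : Metric.closedBall x (r / 2) ⊆ Metric.ball x r :=
    Metric.closedBall_subset_ball (by linarith)
  obtain ⟨y, hy, hym⟩ := (isCompact_closedBall x (r / 2)).exists_isMaxOn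
    ⟨x, Metric.mem_closedBall_self (by positivity)⟩
    ((hc.mono hsub).sub (f := w) (g := fun y => ⟪q, y⟫) (by fun_prop))
  have hval : ∀ z ∈ Metric.closedBall x (r / 2), w z - ⟪q, z⟫ ≤ w y - ⟪q, y⟫ := hym
  have hx := hval x (Metric.mem_closedBall_self (by positivity))
  refine ⟨y, mem_closedBall_iff_norm.1 hy, ?_, fun z hz => ?_⟩
  · have h1 := hmax y (hsub hy)
    have h2 := neg_le_of_abs_le (abs_real_inner_le_norm q (y - x))
    rw [inner_sub_right] at h2
    rcases (norm_nonneg (y - x)).eq_or_lt with h0 | h0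
    · rw [← h0]; simp
    · refine le_of_mul_le_mul_right ?_ h0
      nlinarith
  · rw [inner_sub_right]
    by_cases hz' : z ∈ Metric.closedBall x (r / 2)
    · linarith [hval z hz']
    · rw [mem_closedBall_iff_norm, not_le] at hz'
      have h1 := hmax z hz
      have h2 := neg_le_of_abs_le (abs_real_inner_le_norm q (z - x))
      rw [inner_sub_right] at h2
      have h3 : ‖q‖ * ‖z - x‖ ≤ ε * ‖z - x‖ * ‖z - x‖ := by
        gcongr
        exact hq.trans (by gcongr)
      linarith [h3.trans_eq (by ring : _ = ε * ‖z - x‖ ^ 2)]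

/-- **Jensen's lemma**: near a strict maximum of a semiconvex function there are points outside any
given null set at which the function is touched from above by an affine function of small slope. -/
theorem exists_affine_contact_notMem [FiniteDimensional ℝ E] [MeasurableSpace E] [BorelSpace E]
    {w : E → ℝ} {x : E} {r ε Λ : ℝ} (hr : 0 < r) (hε : 0 < ε) (hΛ : 0 ≤ Λ)
    (hc : ContinuousOn w (Metric.ball x r))
    (hmax : ∀ y ∈ Metric.ball x r, w y ≤ w x - ε * ‖y - x‖ ^ 2)
    (hsemi : ∀ y ∈ Metric.ball x r, ∃ s, ∀ z ∈ Metric.ball x r,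
      w y + ⟪s, z - y⟫ - Λ * ‖z - y‖ ^ 2 ≤ w z)
    {N : Set E} (hN : volume N = 0) {δ : ℝ} (hδ : 0 < δ) :
    ∃ y q, y ∈ Metric.ball x r ∧ ‖y - x‖ < δ ∧ ‖q‖ < δ ∧ y ∉ N ∧
      ∀ z ∈ Metric.ball x r, w z ≤ w y + ⟪q, z - y⟫ := by
  by_contra! hcon
  have hlow : ∀ y q, y ∈ Metric.ball x r → (∀ z ∈ Metric.ball x r, w z ≤ w y + ⟪q, z - y⟫) →
      ∀ z ∈ Metric.ball x r, w y + ⟪q, z - y⟫ - Λ * ‖z - y‖ ^ 2 ≤ w z := fun y q hy hq => by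
    obtain ⟨s, hs⟩ := hsemi y hy
    obtain ⟨ρ, hρ, hρB⟩ := Metric.mem_nhds_iff.1 (Metric.isOpen_ball.mem_nhds hy)
    have h0 : s - q = 0 := eq_zero_of_inner_le_mul_norm_sq (C := Λ) hρ fun z hz => by
      have hzB := hρB (by simpa using hz : y + z ∈ Metric.ball y ρ)
      have h1 := hs _ hzB
      have h2 := hq _ hzB
      rw [add_sub_cancel_left] at h1 h2
      rw [inner_sub_left]
      linarith
    rwa [sub_eq_zero.1 h0] at hs
  have hsub : ∀ y : E, ‖y - x‖ ≤ r / 4 → y ∈ Metric.ball x r := fun y hy => by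
    rw [mem_ball_iff_norm]; linarith
  obtain ⟨K, Φ, hΦ, hΦR⟩ := exists_lipschitzWith_of_rel (C := 4 * Λ)
    (R := fun y q => ‖y - x‖ ≤ r / 4 ∧ ∀ z ∈ Metric.ball x r, w z ≤ w y + ⟪q, z - y⟫)
    fun y q y' q' h h' => by
      have hyy : ‖y - y'‖ ≤ r / 2 := by
        rw [← sub_sub_sub_cancel_right y y' x]
        linarith [norm_sub_le (y - x) (y' - x), h.1, h'.1]
      refine norm_sub_le_of_contact hΛ (fun z hz => ?_)
        (Metric.isOpen_ball.mem_nhds (hsub y' h'.1)) (hlow y' q' (hsub y' h'.1) h'.2) h'.2 h.2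
      rw [mem_closedBall_iff_norm] at hz
      rw [mem_ball_iff_norm, ← sub_add_sub_cancel z y x]
      linarith [norm_add_le (z - y) (y - x), h.1]
  set ρ : ℝ := min δ (ε * min δ (r / 4)) with hρ
  have hρ0 : 0 < ρ := by positivity
  have hball : Metric.ball (0 : E) ρ ⊆ Φ '' N := fun q hq => by
    rw [mem_ball_zero_iff] at hq
    have hq1 : ‖q‖ < δ := hq.trans_le (min_le_left _ _)
    have hq2 : ‖q‖ < ε * min δ (r / 4) := hq.trans_le (min_le_right _ _)
    obtain ⟨y, -, hy2, hy3⟩ := exists_affine_contact hr hε hc hmax (q := q)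
      (hq2.le.trans (by gcongr; exact (min_le_right _ _).trans (by linarith)))
    have hy4 : ‖y - x‖ < min δ (r / 4) := lt_of_mul_lt_mul_left (hy2.trans_lt hq2) hε.le
    have hy5 : ‖y - x‖ ≤ r / 4 := hy4.le.trans (min_le_right _ _)
    refine ⟨y, ?_, hΦR _ _ ⟨hy5, hy3⟩⟩
    by_contra hyN
    obtain ⟨z, hz, hz'⟩ := hcon y q (hsub y hy5) (hy4.trans_le (min_le_left _ _)) hq1 hyN
    exact absurd (hy3 z hz) hz'.not_ge
  exact (Metric.measure_ball_pos volume (0 : E) hρ0).ne'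
    (measure_mono_null hball (hΦ.volume_image_eq_zero hN))

end Contact

section Jets

variable {n : ℕ}

theorem quad_eq_inner (A : Matrix (Fin n) (Fin n) ℝ) (v : EuclideanSpace ℝ (Fin n)) :
    quad A v = ⟪Matrix.toEuclideanCLM (𝕜 := ℝ) A v, v⟫ := by
  rw [real_inner_comm, Matrix.inner_toEuclideanCLM]
  simp only [quad, dotProduct, Matrix.mulVec, Finset.mul_sum]
  refine Finset.sum_congr rfl fun i _ => Finset.sum_congr rfl fun j _ => by ring

theorem quad_add (A B : Matrix (Fin n) (Fin n) ℝ) (v : EuclideanSpace ℝ (Fin n)) :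
    quad (A + B) v = quad A v + quad B v := by
  simp only [quad_eq_inner, map_add, add_apply, inner_add_left]

theorem quad_sub (A B : Matrix (Fin n) (Fin n) ℝ) (v : EuclideanSpace ℝ (Fin n)) :
    quad (A - B) v = quad A v - quad B v := by
  simp only [quad_eq_inner, map_sub, sub_apply, inner_sub_left]

theorem quad_smul (A : Matrix (Fin n) (Fin n) ℝ) (c : ℝ) (v : EuclideanSpace ℝ (Fin n)) :
    quad (c • A) v = c * quad A v := by
  simp only [quad_eq_inner, map_smul, smul_apply, inner_smul_left, conj_trivial]

theorem quad_one (v : EuclideanSpace ℝ (Fin n)) :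
    quad (1 : Matrix (Fin n) (Fin n) ℝ) v = ‖v‖ ^ 2 := by
  rw [quad_eq_inner, map_one, one_apply_eq_self, real_inner_self_eq_norm_sq]

theorem quad_transpose (A : Matrix (Fin n) (Fin n) ℝ) (v : EuclideanSpace ℝ (Fin n)) :
    quad A.transpose v = quad A v := by
  unfold quad
  rw [Finset.sum_comm]
  refine Finset.sum_congr rfl fun i _ => Finset.sum_congr rfl fun j _ => ?_
  rw [Matrix.transpose_apply]
  ring

theorem quad_apply_smul (A : Matrix (Fin n) (Fin n) ℝ) (t : ℝ) (v : EuclideanSpace ℝ (Fin n)) :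
    quad A (t • v) = t ^ 2 * quad A v := by
  rw [quad_eq_inner, quad_eq_inner, map_smul, inner_smul_left, inner_smul_right, conj_trivial]
  ring

theorem abs_quad_le (A : Matrix (Fin n) (Fin n) ℝ) (v : EuclideanSpace ℝ (Fin n)) :
    |quad A v| ≤ ‖Matrix.toEuclideanCLM (𝕜 := ℝ) A‖ * ‖v‖ ^ 2 := by
  rw [quad_eq_inner]
  calc _ ≤ _ := abs_real_inner_le_norm _ _
    _ ≤ ‖Matrix.toEuclideanCLM (𝕜 := ℝ) A‖ * ‖v‖ * ‖v‖ := by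
      gcongr; exact ContinuousLinearMap.le_opNorm _ _
    _ = _ := by ring

theorem Matrix.IsSymm.quad_expand {A : Matrix (Fin n) (Fin n) ℝ} (hA : A.IsSymm)
    (a h : EuclideanSpace ℝ (Fin n)) :
    quad A (a + h) = quad A a + 2 * ⟪Matrix.toEuclideanCLM (𝕜 := ℝ) A a, h⟫ + quad A h := by
  have hsymm : ⟪Matrix.toEuclideanCLM (𝕜 := ℝ) A h, a⟫
      = ⟪Matrix.toEuclideanCLM (𝕜 := ℝ) A a, h⟫ := by
    rw [real_inner_comm, Matrix.inner_toEuclideanCLM, real_inner_comm, Matrix.inner_toEuclideanCLM,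
      Matrix.dotProduct_mulVec, ← Matrix.mulVec_transpose, hA.eq, dotProduct_comm]
  simp only [quad_eq_inner, map_add, inner_add_left, inner_add_right, hsymm]
  ring

theorem posSemidef_of_quad_nonneg {A : Matrix (Fin n) (Fin n) ℝ} (hA : A.IsSymm)
    (h : ∀ v, 0 ≤ quad A v) : A.PosSemidef := by
  refine Matrix.PosSemidef.of_dotProduct_mulVec_nonneg ?_ fun v => ?_
  · rw [Matrix.IsHermitian, Matrix.conjTranspose_eq_transpose_of_trivial, hA.eq]
  · have := h (WithLp.toLp 2 v)
    rwa [quad_eq_inner, real_inner_comm, Matrix.inner_toEuclideanCLM] at this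

theorem TwiceDiffAt.eventually_abs_le {w : EuclideanSpace ℝ (Fin n) → ℝ}
    {x g : EuclideanSpace ℝ (Fin n)} {H : Matrix (Fin n) (Fin n) ℝ} (h : TwiceDiffAt w x g H)
    {ε : ℝ} (hε : 0 < ε) :
    ∀ᶠ y in 𝓝 x, |w y - w x - ⟪g, y - x⟫ - (1 / 2) * quad H (y - x)| ≤ ε * ‖y - x‖ ^ 2 := by
  filter_upwards [h.2.def hε] with y hy
  simpa only [Real.norm_eq_abs, abs_pow, abs_norm] using hy

theorem TwiceDiffAt.upperContactJet {w : EuclideanSpace ℝ (Fin n) → ℝ}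
    {x g : EuclideanSpace ℝ (Fin n)} {H : Matrix (Fin n) (Fin n) ℝ} (h : TwiceDiffAt w x g H)
    {ε : ℝ} (hε : 0 < ε) : UpperContactJet w x g (H + ε • 1) := by
  filter_upwards [h.eventually_abs_le (half_pos hε)] with y hy
  rw [quad_add, quad_smul, quad_one]
  linarith [(abs_le.1 hy).2]

theorem TwiceDiffAt.of_upperContactJet {w : EuclideanSpace ℝ (Fin n) → ℝ}
    {x g p : EuclideanSpace ℝ (Fin n)} {H A : Matrix (Fin n) (Fin n) ℝ} (h : TwiceDiffAt w x g H)
    (hA : UpperContactJet w x p A) : g = p ∧ ∀ v, quad H v ≤ quad A v := by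
  have hgp : g = p := by
    obtain ⟨r, hr, hb⟩ := Metric.eventually_nhds_iff.1 ((h.eventually_abs_le one_pos).and hA)
    rw [← sub_eq_zero]
    refine eq_zero_of_inner_le_mul_norm_sq (C := 1 + ‖Matrix.toEuclideanCLM (𝕜 := ℝ) H‖ / 2 +
      ‖Matrix.toEuclideanCLM (𝕜 := ℝ) A‖ / 2) hr fun z hz => ?_
    obtain ⟨h1, h2⟩ := hb (y := x + z) (by simpa using hz)
    rw [add_sub_cancel_left] at h1 h2
    rw [inner_sub_left]
    linarith [(abs_le.1 h1).1, (abs_le.1 (abs_quad_le H z)).1, (abs_le.1 (abs_quad_le A z)).2]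
  subst hgp
  refine ⟨rfl, fun v => ?_⟩
  have key : ∀ c > 0, quad H v ≤ quad A v + 2 * c * ‖v‖ ^ 2 := fun c hc => by
    have ht : Tendsto (fun t : ℝ => x + t • v) (𝓝[>] 0) (𝓝 x) := by
      have : Continuous fun t : ℝ => x + t • v := by fun_prop
      simpa using (this.tendsto 0).mono_left nhdsWithin_le_nhds
    obtain ⟨t, ⟨h1, h2⟩, ht0⟩ := ((ht.eventually ((h.eventually_abs_le hc).and hA)).and
      self_mem_nhdsWithin).exists
    replace ht0 : 0 < t := ht0
    rw [add_sub_cancel_left, quad_apply_smul] at h1 h2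
    rw [norm_smul, mul_pow, Real.norm_of_nonneg ht0.le] at h1
    have h3 : t ^ 2 * quad H v ≤ t ^ 2 * (quad A v + 2 * c * ‖v‖ ^ 2) := by
      linarith [(abs_le.1 h1).1]
    exact le_of_mul_le_mul_left h3 (by positivity)
  have ht : Tendsto (fun c : ℝ => quad A v + 2 * c * ‖v‖ ^ 2) (𝓝[>] 0) (𝓝 (quad A v)) := by
    have : Continuous fun c : ℝ => quad A v + 2 * c * ‖v‖ ^ 2 := by fun_prop
    simpa using (this.tendsto 0).mono_left nhdsWithin_le_nhds
  exact ge_of_tendsto ht (eventually_nhdsWithin_of_forall key)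

theorem norm_sq_expand {E : Type*} [NormedAddCommGroup E] [InnerProductSpace ℝ E] (x y : E) :
    ‖y‖ ^ 2 = ‖x‖ ^ 2 + 2 * ⟪x, y - x⟫ + ‖y - x‖ ^ 2 := by
  rw [← norm_add_sq_real, add_sub_cancel]

/-- Alexandrov's theorem for quasi-convex functions. -/
theorem QCOn.ae_twiceDiffAt {lam : ℝ} {U : Set (EuclideanSpace ℝ (Fin n))}
    {u : EuclideanSpace ℝ (Fin n) → ℝ} (hqc : QCOn lam U u) (hU : IsOpen U) :
    ∀ᵐ x, x ∈ U → ∃ g H, H.IsSymm ∧ TwiceDiffAt u x g H := by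
  filter_upwards [ConvexOn.ae_exists_taylor_two hqc hU] with x hx hxU
  obtain ⟨p, L, hp, hL⟩ := hx hxU
  set H₀ : Matrix (Fin n) (Fin n) ℝ := (Matrix.toEuclideanCLM (𝕜 := ℝ)).symm L with hH₀
  have hquad : ∀ v, quad ((1 / 2 : ℝ) • (H₀ + H₀.transpose) - lam • 1) v
      = ⟪L v, v⟫ - lam * ‖v‖ ^ 2 := fun v => by
    have : quad H₀ v = ⟪L v, v⟫ := by
      rw [quad_eq_inner, hH₀, StarAlgEquiv.apply_symm_apply]
    rw [quad_sub, quad_smul, quad_smul, quad_add, quad_transpose, quad_one, this]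
    ring
  refine ⟨p - lam • x, (1 / 2 : ℝ) • (H₀ + H₀.transpose) - lam • 1, ?_, ?_, ?_⟩
  · exact ((Matrix.isSymm_add_transpose_self H₀).smul _).sub (Matrix.isSymm_one.smul _)
  · rw [hasGradientAt_iff_isLittleO] at hp ⊢
    refine (hp.sub ((Asymptotics.isLittleO_pow_sub_sub x one_lt_two).const_mul_left
      (lam / 2))).congr_left fun y => ?_
    rw [inner_sub_left, inner_smul_left, conj_trivial, norm_sq_expand x y]
    ring
  · refine hL.congr_left fun y => ?_
    rw [hquad, inner_sub_left, inner_smul_left, conj_trivial, norm_sq_expand x y]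
    ring

theorem QCOn.continuousOn {lam : ℝ} {U : Set (EuclideanSpace ℝ (Fin n))}
    {u : EuclideanSpace ℝ (Fin n) → ℝ} (hqc : QCOn lam U u) (hU : IsOpen U) :
    ContinuousOn u U := by
  have h : ContinuousOn _ U := ConvexOn.continuousOn hU hqc
  have h2 : ContinuousOn (fun x : EuclideanSpace ℝ (Fin n) => lam / 2 * ‖x‖ ^ 2) U := by fun_prop
  exact (h.sub h2).congr fun x _ => by simp

theorem QCOn.exists_paraboloid_le {lam : ℝ} {U : Set (EuclideanSpace ℝ (Fin n))}
    {u : EuclideanSpace ℝ (Fin n) → ℝ} (hqc : QCOn lam U u) (hU : IsOpen U)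
    {y : EuclideanSpace ℝ (Fin n)} (hy : y ∈ U) :
    ∃ s, ∀ z ∈ U, u y + ⟪s, z - y⟫ - lam / 2 * ‖z - y‖ ^ 2 ≤ u z := by
  obtain ⟨s, hs⟩ := ConvexOn.exists_isSubgradientOn hqc hU (ConvexOn.continuousOn hU hqc) hy
  refine ⟨s - lam • y, fun z hz => ?_⟩
  have h1 := hs z hz
  beta_reduce at h1
  rw [norm_sq_expand y z] at h1
  rw [inner_sub_left, inner_smul_left, conj_trivial]
  linarith

/-- Every upper contact jet of a quasi-convex function is approximated by upper contact jets at
points outside a given null set. -/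
theorem QCOn.exists_upperContactJet_notMem {lam : ℝ} {U : Set (EuclideanSpace ℝ (Fin n))}
    {u : EuclideanSpace ℝ (Fin n) → ℝ} (hqc : QCOn lam U u) (hlam : 0 ≤ lam) (hU : IsOpen U)
    {x p : EuclideanSpace ℝ (Fin n)} {A : Matrix (Fin n) (Fin n) ℝ} (hx : x ∈ U) (hA : A.IsSymm)
    (hjet : UpperContactJet u x p A) {N : Set (EuclideanSpace ℝ (Fin n))} (hN : volume N = 0)
    {ε : ℝ} (hε : 0 < ε) :
    ∃ y q, y ∈ U ∧ y ∉ N ∧ ‖y - x‖ < ε ∧ ‖q‖ < ε ∧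
      UpperContactJet u y (q + p + Matrix.toEuclideanCLM (𝕜 := ℝ) A (y - x) + (2 * ε) • (y - x))
        (A + (2 * ε) • 1) := by
  obtain ⟨r, hr, hb⟩ := Metric.eventually_nhds_iff.1 (hjet.and (hU.mem_nhds hx))
  set T := Matrix.toEuclideanCLM (𝕜 := ℝ) A with hT
  set w : EuclideanSpace ℝ (Fin n) → ℝ := fun y =>
    u y - ⟪p, y - x⟫ - 1 / 2 * quad A (y - x) - ε * ‖y - x‖ ^ 2 with hw
  have hwx : w x = u x := by simp [hw, quad]
  have hexp : ∀ y z, w z - w y = u z - u y - ⟪p + T (y - x) + (2 * ε) • (y - x), z - y⟫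
      - 1 / 2 * quad A (z - y) - ε * ‖z - y‖ ^ 2 := fun y z => by
    have e1 : z - x = (y - x) + (z - y) := by abel
    simp only [hw]
    rw [e1, hA.quad_expand, norm_add_sq_real, inner_add_left, inner_add_left, inner_smul_left,
      conj_trivial, inner_add_right]
    ring
  have hBU : Metric.ball x r ⊆ U := fun y hy => (hb hy).2
  have hcont : ContinuousOn w (Metric.ball x r) := by
    have h1 := (hqc.continuousOn hU).mono hBU
    simp only [hw, quad_eq_inner]
    fun_prop
  obtain ⟨y, q, hy, hyx, hq, hyN, hcontact⟩ := exists_affine_contact_notMem (w := w)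
    (Λ := lam / 2 + ‖T‖ / 2 + ε) hr hε (by positivity) hcont
    (fun y hy => by
      rw [hwx]
      have := (hb hy).1
      simp only [hw]
      linarith)
    (fun y hy => by
      obtain ⟨s, hs⟩ := hqc.exists_paraboloid_le hU (hBU hy)
      refine ⟨s - (p + T (y - x) + (2 * ε) • (y - x)), fun z hz => ?_⟩
      have h1 := hs z (hBU hz)
      have h2 := hexp y z
      have h3 := (abs_le.1 (abs_quad_le A (z - y))).2
      rw [← hT] at h3
      rw [inner_sub_left]
      linarith) hN hε
  refine ⟨y, q, hBU hy, hyN, hyx, hq, ?_⟩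
  filter_upwards [Metric.isOpen_ball.mem_nhds hy] with z hz
  have h1 := hcontact z hz
  have h2 := hexp y z
  have e : q + p + T (y - x) + (2 * ε) • (y - x) = q + (p + T (y - x) + (2 * ε) • (y - x)) := by
    abel
  rw [e, inner_add_left, quad_add, quad_smul, quad_one]
  linarith

end Jets

/-- For a quasi-convex function `u` and a closed set `F` of 2-jets satisfying positivity,
`u` is `F`-subharmonic on `U` if and only if the a.e. 2-jet of `u` lies in `F`. -/
theorem stmt_15 {n : ℕ} (F : Set (Jet n)) (hFc : IsClosed F) (hFp : Positivity F)
    (U : Set (EuclideanSpace ℝ (Fin n))) (hU : IsOpen U)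
    (u : EuclideanSpace ℝ (Fin n) → ℝ) (lam : ℝ) (hlam : 0 ≤ lam)
    (hqc : QCOn lam U u) :
    Subharm F U u ↔
      ∀ᵐ x ∂(volume.restrict U),
        ∃ (g : EuclideanSpace ℝ (Fin n)) (H : Matrix (Fin n) (Fin n) ℝ),
          H.IsSymm ∧ TwiceDiffAt u x g H ∧ (x, u x, g, H) ∈ F := by
  constructor
  · intro hsub
    rw [ae_restrict_iff' hU.measurableSet]
    filter_upwards [hqc.ae_twiceDiffAt hU] with x hx hxU
    obtain ⟨g, H, hH, hd⟩ := hx hxU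
    refine ⟨g, H, hH, hd, ?_⟩
    have ht : Tendsto (fun ε : ℝ => ((x, u x, g, H + ε • 1) : Jet n)) (𝓝[>] 0)
        (𝓝 (x, u x, g, H)) := by
      have : Continuous fun ε : ℝ => ((x, u x, g, H + ε • 1) : Jet n) := by fun_prop
      simpa using (this.tendsto 0).mono_left nhdsWithin_le_nhds
    exact hFc.mem_of_tendsto ht (eventually_nhdsWithin_of_forall fun ε hε =>
      hsub x hxU g _ (hH.add (Matrix.isSymm_one.smul _)) (hd.upperContactJet hε))
  · intro hae x hxU p A hA hjet
    rw [ae_restrict_iff' hU.measurableSet, ae_iff] at hae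
    set ε : ℕ → ℝ := fun k => 1 / ((k : ℝ) + 1) with hε
    have hε0 : ∀ k, 0 < ε k := fun k => by positivity
    have hεt : Tendsto ε atTop (𝓝 0) := tendsto_one_div_add_atTop_nhds_zero_nat
    choose y q hyU hyN hyx hq hj using fun k =>
      hqc.exists_upperContactJet_notMem hlam hU hxU hA hjet hae (hε0 k)
    have hyt : Tendsto y atTop (𝓝 x) :=
      tendsto_iff_norm_sub_tendsto_zero.2
        (squeeze_zero (fun _ => norm_nonneg _) (fun k => (hyx k).le) hεt)
    have hqt : Tendsto q atTop (𝓝 0) :=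
      squeeze_zero_norm (fun k => (hq k).le) hεt
    have hut : Tendsto (fun k => u (y k)) atTop (𝓝 (u x)) :=
      ((hqc.continuousOn hU).continuousAt (hU.mem_nhds hxU)).tendsto.comp hyt
    have hmem : ∀ k, ((y k, u (y k), q k + p + Matrix.toEuclideanCLM (𝕜 := ℝ) A (y k - x) +
        (2 * ε k) • (y k - x), A + (2 * ε k) • 1) : Jet n) ∈ F := fun k => by
      have hk := hyN k
      rw [Set.mem_ofPred_eq, not_not] at hk
      obtain ⟨g, H, hH, hd, hF⟩ := hk (hyU k)
      obtain ⟨rfl, hle⟩ := hd.of_upperContactJet (hj k)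
      have hP := hFp _ _ _ _ _ hF (posSemidef_of_quad_nonneg
        (((hA.add (Matrix.isSymm_one.smul (2 * ε k)))).sub hH)
        fun v => by rw [quad_sub]; exact sub_nonneg.2 (hle v))
      rwa [add_sub_cancel] at hP
    have hyx0 : Tendsto (fun k => y k - x) atTop (𝓝 0) := by simpa using hyt.sub_const x
    have hgt := ((hqt.add_const p).add
      (((Matrix.toEuclideanCLM (𝕜 := ℝ) A).continuous.tendsto 0).comp hyx0)).add
      ((hεt.const_mul 2).smul hyx0)
    have hAt := ((hεt.const_mul 2).smul_const (1 : Matrix (Fin n) (Fin n) ℝ)).const_add A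
    simp only [map_zero, zero_add, mul_zero, zero_smul, add_zero] at hgt hAt
    exact hFc.mem_of_tendsto (hyt.prodMk_nhds (hut.prodMk_nhds (hgt.prodMk_nhds hAt)))
      (Eventually.of_forall hmem)
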